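/- (Polyak–Łojasiewicz inequality for the inner loop.) Let K ∈ 𝒦. Then for every maximizer gain L, G(K,L(K)) − G(K,L) ≤ (max_{0≤t≤N} λ_max(X^{K,L(K)}_t) / (φ² · min_{0≤t≤N−1} λ_min(R^w_t − D_tᵀP^K_{t+1}D_t))) · Σ_{t=0}^{N−1} ‖E^{K,L}_t X^{K,L}_t‖_F², i.e. the squared gradient norm of G(K,·) dominates the optimality gap up to the constant μ_K := 4 φ² min_t λ_min(R^w_t − D_tᵀP^K_{t+1}D_t) / max_t λ_max(X^{K,L(K)}_t) (noting that the gradient of G(K,·) at L has blocks 2E^{K,L}_tX^{K,L}_t). -/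

import Mathlib

open Matrix

noncomputable section

/-- Rayleigh-quotient value set of a square real matrix. -/
def rayleighSet {a : ℕ} (M : Matrix (Fin a) (Fin a) ℝ) : Set ℝ :=
  { r : ℝ | ∃ x : Fin a → ℝ, x ⬝ᵥ x = 1 ∧ r = x ⬝ᵥ M.mulVec x }

/-- Smallest eigenvalue (of a symmetric matrix), via the Rayleigh characterization. -/
def eigMin {a : ℕ} (M : Matrix (Fin a) (Fin a) ℝ) : ℝ := sInf (rayleighSet M)

/-- Largest eigenvalue (of a symmetric matrix), via the Rayleigh characterization. -/
def eigMax {a : ℕ} (M : Matrix (Fin a) (Fin a) ℝ) : ℝ := sSup (rayleighSet M)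

/-- Operator (spectral) norm of a real matrix. -/
def opNorm {a b : ℕ} (M : Matrix (Fin a) (Fin b) ℝ) : ℝ := Real.sqrt (eigMax (Mᵀ * M))

/-- Squared Frobenius norm. -/
def frobNormSq {a b : ℕ} (M : Matrix (Fin a) (Fin b) ℝ) : ℝ := ∑ i, ∑ j, (M i j) ^ 2

/-- Frobenius norm. -/
def frobNorm {a b : ℕ} (M : Matrix (Fin a) (Fin b) ℝ) : ℝ := Real.sqrt (frobNormSq M)

/-- Extend a finite tuple to a function on `ℕ` by zero. -/
def padZero {α : Type*} [Zero α] {N : ℕ} (f : Fin N → α) : ℕ → α :=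
  fun t => if h : t < N then f ⟨t, h⟩ else 0

/-- Data of a finite-horizon zero-sum LQ dynamic game with horizon `N`. -/
structure LQGame (m d n N : ℕ) where
  A : ℕ → Matrix (Fin m) (Fin m) ℝ
  B : ℕ → Matrix (Fin m) (Fin d) ℝ
  D : ℕ → Matrix (Fin m) (Fin n) ℝ
  Q : ℕ → Matrix (Fin m) (Fin m) ℝ
  QN : Matrix (Fin m) (Fin m) ℝ
  Ru : ℕ → Matrix (Fin d) (Fin d) ℝ
  Rw : ℕ → Matrix (Fin n) (Fin n) ℝ
  Sig : ℕ → Matrix (Fin m) (Fin m) ℝ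
  hQ : ∀ t < N, (Q t).PosSemidef
  hQN : QN.PosSemidef
  hRu : ∀ t < N, (Ru t).PosDef
  hRw : ∀ t < N, (Rw t).PosDef
  hSig : ∀ t ≤ N, (Sig t).PosDef

namespace LQGame

variable {m d n N : ℕ}

/-- Value matrices `P^{K,L}` indexed by the number `j` of steps before the terminal
time, i.e. `PKLaux g K L j = P^{K,L}_{N-j}`. -/
def PKLaux (g : LQGame m d n N) (K : ℕ → Matrix (Fin d) (Fin m) ℝ)
    (L : ℕ → Matrix (Fin n) (Fin m) ℝ) : ℕ → Matrix (Fin m) (Fin m) ℝ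
  | 0 => g.QN
  | j + 1 =>
      (g.A (N - (j+1)) - g.B (N - (j+1)) * K (N - (j+1)) - g.D (N - (j+1)) * L (N - (j+1)))ᵀ *
          PKLaux g K L j *
          (g.A (N - (j+1)) - g.B (N - (j+1)) * K (N - (j+1)) - g.D (N - (j+1)) * L (N - (j+1)))
        + g.Q (N - (j+1)) + (K (N - (j+1)))ᵀ * g.Ru (N - (j+1)) * K (N - (j+1))
        - (L (N - (j+1)))ᵀ * g.Rw (N - (j+1)) * L (N - (j+1))

/-- Value matrix `P^{K,L}_t`. -/
def PKL (g : LQGame m d n N) (K : ℕ → Matrix (Fin d) (Fin m) ℝ)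
    (L : ℕ → Matrix (Fin n) (Fin m) ℝ) (t : ℕ) : Matrix (Fin m) (Fin m) ℝ :=
  PKLaux g K L (N - t)

/-- Inner-loop Riccati matrices indexed by the number `j` of steps before the terminal
time, i.e. `PKaux g K j = P^K_{N-j}`. -/
def PKaux (g : LQGame m d n N) (K : ℕ → Matrix (Fin d) (Fin m) ℝ) :
    ℕ → Matrix (Fin m) (Fin m) ℝ
  | 0 => g.QN
  | j + 1 =>
      g.Q (N - (j+1)) + (K (N - (j+1)))ᵀ * g.Ru (N - (j+1)) * K (N - (j+1))
        + (g.A (N - (j+1)) - g.B (N - (j+1)) * K (N - (j+1)))ᵀ *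
          (PKaux g K j + PKaux g K j * g.D (N - (j+1)) *
            (g.Rw (N - (j+1)) - (g.D (N - (j+1)))ᵀ * PKaux g K j * g.D (N - (j+1)))⁻¹ *
            (g.D (N - (j+1)))ᵀ * PKaux g K j) *
          (g.A (N - (j+1)) - g.B (N - (j+1)) * K (N - (j+1)))

/-- Inner-loop Riccati matrix `P^K_t`. -/
def PK (g : LQGame m d n N) (K : ℕ → Matrix (Fin d) (Fin m) ℝ) (t : ℕ) :
    Matrix (Fin m) (Fin m) ℝ :=
  PKaux g K (N - t)

/-- `P̃^K_{t+1}`. -/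
def Ptilde (g : LQGame m d n N) (K : ℕ → Matrix (Fin d) (Fin m) ℝ) (t : ℕ) :
    Matrix (Fin m) (Fin m) ℝ :=
  g.PK K (t+1) + g.PK K (t+1) * g.D t *
    (g.Rw t - (g.D t)ᵀ * g.PK K (t+1) * g.D t)⁻¹ * (g.D t)ᵀ * g.PK K (t+1)

/-- `K ∈ 𝒦`. -/
def Admissible (g : LQGame m d n N) (K : ℕ → Matrix (Fin d) (Fin m) ℝ) : Prop :=
  ∀ t < N, (g.Rw t - (g.D t)ᵀ * g.PK K (t+1) * g.D t).PosDef

/-- The inner maximizer `L(K)`. -/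
def Lopt (g : LQGame m d n N) (K : ℕ → Matrix (Fin d) (Fin m) ℝ) (t : ℕ) :
    Matrix (Fin n) (Fin m) ℝ :=
  (-(g.Rw t) + (g.D t)ᵀ * g.PK K (t+1) * g.D t)⁻¹ *
    ((g.D t)ᵀ * g.PK K (t+1) * (g.A t - g.B t * K t))

/-- State covariances `X^{K,L}_t`. -/
def Xcov (g : LQGame m d n N) (K : ℕ → Matrix (Fin d) (Fin m) ℝ)
    (L : ℕ → Matrix (Fin n) (Fin m) ℝ) : ℕ → Matrix (Fin m) (Fin m) ℝ
  | 0 => g.Sig 0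
  | t + 1 =>
      (g.A t - g.B t * K t - g.D t * L t) * Xcov g K L t *
        (g.A t - g.B t * K t - g.D t * L t)ᵀ + g.Sig (t+1)

/-- The game value `G(K,L)`. -/
def value (g : LQGame m d n N) (K : ℕ → Matrix (Fin d) (Fin m) ℝ)
    (L : ℕ → Matrix (Fin n) (Fin m) ℝ) : ℝ :=
  ∑ t ∈ Finset.range (N+1), ((g.PKL K L t) * g.Sig t).trace

/-- `E^{K,L}_t`. -/
def Emat (g : LQGame m d n N) (K : ℕ → Matrix (Fin d) (Fin m) ℝ)
    (L : ℕ → Matrix (Fin n) (Fin m) ℝ) (t : ℕ) : Matrix (Fin n) (Fin m) ℝ :=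
  (-(g.Rw t) + (g.D t)ᵀ * g.PKL K L (t+1) * g.D t) * L t -
    (g.D t)ᵀ * g.PKL K L (t+1) * (g.A t - g.B t * K t)

/-- `H^{K,L}_t`. -/
def Hmat (g : LQGame m d n N) (K : ℕ → Matrix (Fin d) (Fin m) ℝ)
    (L : ℕ → Matrix (Fin n) (Fin m) ℝ) (t : ℕ) : Matrix (Fin n) (Fin n) ℝ :=
  g.Rw t - (g.D t)ᵀ * g.PKL K L (t+1) * g.D t

/-- `F^K_t`. -/
def Fmat (g : LQGame m d n N) (K : ℕ → Matrix (Fin d) (Fin m) ℝ) (t : ℕ) :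
    Matrix (Fin d) (Fin m) ℝ :=
  (g.Ru t + (g.B t)ᵀ * g.Ptilde K t * g.B t) * K t - (g.B t)ᵀ * g.Ptilde K t * g.A t

/-- `G^K_t`. -/
def Gmat (g : LQGame m d n N) (K : ℕ → Matrix (Fin d) (Fin m) ℝ) (t : ℕ) :
    Matrix (Fin d) (Fin d) ℝ :=
  g.Ru t + (g.B t)ᵀ * g.Ptilde K t * g.B t

/-- Game Riccati recursion `P*` indexed by steps before terminal time. -/
def Pstaraux (g : LQGame m d n N) : ℕ → Matrix (Fin m) (Fin m) ℝ
  | 0 => g.QN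
  | j + 1 =>
      g.Q (N - (j+1)) + (g.A (N - (j+1)))ᵀ * Pstaraux g j *
        (1 + (g.B (N - (j+1)) * (g.Ru (N - (j+1)))⁻¹ * (g.B (N - (j+1)))ᵀ
            - g.D (N - (j+1)) * (g.Rw (N - (j+1)))⁻¹ * (g.D (N - (j+1)))ᵀ) * Pstaraux g j)⁻¹ *
        g.A (N - (j+1))

/-- `P*_t`. -/
def Pstar (g : LQGame m d n N) (t : ℕ) : Matrix (Fin m) (Fin m) ℝ :=
  Pstaraux g (N - t)

/-- `Λ_t` of the game Riccati recursion. -/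
def LambdaStar (g : LQGame m d n N) (t : ℕ) : Matrix (Fin m) (Fin m) ℝ :=
  1 + (g.B t * (g.Ru t)⁻¹ * (g.B t)ᵀ - g.D t * (g.Rw t)⁻¹ * (g.D t)ᵀ) * g.Pstar (t+1)

/-- Assumption 2.4. -/
def Assumption24 (g : LQGame m d n N) : Prop :=
  (∀ t < N, IsUnit (g.LambdaStar t)) ∧ (∀ t ≤ N, (g.Pstar t).PosSemidef) ∧
    (∀ t < N, (g.Rw t - (g.D t)ᵀ * g.Pstar (t+1) * g.D t).PosDef)

/-- `φ := min_{0 ≤ t ≤ N} λ_min(Σ⁰_t)`. -/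
def phi (g : LQGame m d n N) : ℝ :=
  (Finset.range (N+1)).inf' (Finset.nonempty_range_iff.mpr (Nat.succ_ne_zero N))
    (fun t => eigMin (g.Sig t))

end LQGame

theorem isCompact_rayleighSet {a : ℕ} (M : Matrix (Fin a) (Fin a) ℝ) :
    IsCompact (rayleighSet M) := by
  have hsphere : IsCompact {x : Fin a → ℝ | x ⬝ᵥ x = 1} := by
    refine (isCompact_univ_pi fun _ : Fin a =>
      isCompact_Icc (a := (-1 : ℝ)) (b := 1)).of_isClosed_subset
      (isClosed_eq (by fun_prop) continuous_const) fun x hx i _ => ?_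
    have hle : x i * x i ≤ x ⬝ᵥ x :=
      Finset.single_le_sum (f := fun j => x j * x j) (fun j _ => mul_self_nonneg (x j))
        (Finset.mem_univ i)
    rw [show x ⬝ᵥ x = 1 from hx] at hle
    exact abs_le.mp (abs_le_one_iff_mul_self_le_one.mpr hle)
  convert hsphere.image (f := fun x => x ⬝ᵥ M *ᵥ x) (by fun_prop) using 1
  ext r
  exact exists_congr fun x => and_congr_right fun _ => eq_comm

theorem rayleighSet_nonempty {a : ℕ} (ha : 0 < a) (M : Matrix (Fin a) (Fin a) ℝ) :
    (rayleighSet M).Nonempty :=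
  ⟨_, Pi.single ⟨0, ha⟩ 1, by simp, rfl⟩

theorem eigMin_pos {a : ℕ} (ha : 0 < a) {M : Matrix (Fin a) (Fin a) ℝ} (hM : M.PosDef) :
    0 < eigMin M := by
  obtain ⟨x, hx, hr⟩ := (isCompact_rayleighSet M).sInf_mem (rayleighSet_nonempty ha M)
  rw [eigMin, hr]
  have hx0 : x ≠ 0 := by
    rintro rfl
    simp at hx
  simpa using hM.dotProduct_mulVec_pos hx0

theorem eigMax_nonneg {a : ℕ} {M : Matrix (Fin a) (Fin a) ℝ} (hM : M.PosSemidef) :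
    0 ≤ eigMax M := by
  refine Real.sSup_nonneg ?_
  rintro _ ⟨x, -, rfl⟩
  simpa using hM.dotProduct_mulVec_nonneg x

theorem div_mem_rayleighSet {a : ℕ} (M : Matrix (Fin a) (Fin a) ℝ) {x : Fin a → ℝ}
    (hx : 0 < x ⬝ᵥ x) : (x ⬝ᵥ M *ᵥ x) / (x ⬝ᵥ x) ∈ rayleighSet M := by
  have hs : √(x ⬝ᵥ x) ≠ 0 := (Real.sqrt_pos.mpr hx).ne'
  have hsq : √(x ⬝ᵥ x) * √(x ⬝ᵥ x) = x ⬝ᵥ x := Real.mul_self_sqrt hx.le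
  refine ⟨(√(x ⬝ᵥ x))⁻¹ • x, ?_, ?_⟩
  · simp only [smul_dotProduct, dotProduct_smul, smul_eq_mul]
    rw [← mul_assoc, ← mul_inv, hsq, inv_mul_cancel₀ hx.ne']
  · simp only [smul_dotProduct, dotProduct_smul, mulVec_smul, smul_eq_mul]
    rw [← mul_assoc, ← mul_inv, hsq, div_eq_inv_mul]

theorem posSemidef_sub_smul_one {a : ℕ} {M : Matrix (Fin a) (Fin a) ℝ} (hM : M.IsHermitian)
    {c : ℝ} (hc : c ≤ eigMin M) : (M - c • 1).PosSemidef := by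
  refine .of_dotProduct_mulVec_nonneg
    (hM.sub (isHermitian_one.smul (IsSelfAdjoint.all c))) fun x => ?_
  simp only [star_trivial, sub_mulVec, smul_mulVec, one_mulVec, dotProduct_sub, dotProduct_smul,
    smul_eq_mul]
  rcases eq_or_ne x 0 with rfl | hx
  · simp
  have hpos : 0 < x ⬝ᵥ x := by simpa using dotProduct_star_self_pos_iff.mpr hx
  have := hc.trans (csInf_le (isCompact_rayleighSet M).bddBelow (div_mem_rayleighSet M hpos))
  linarith [(le_div_iff₀ hpos).mp this]

theorem posSemidef_smul_one_sub {a : ℕ} {M : Matrix (Fin a) (Fin a) ℝ} (hM : M.IsHermitian)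
    {c : ℝ} (hc : eigMax M ≤ c) : (c • 1 - M).PosSemidef := by
  refine .of_dotProduct_mulVec_nonneg
    ((isHermitian_one.smul (IsSelfAdjoint.all c)).sub hM) fun x => ?_
  simp only [star_trivial, sub_mulVec, smul_mulVec, one_mulVec, dotProduct_sub, dotProduct_smul,
    smul_eq_mul]
  rcases eq_or_ne x 0 with rfl | hx
  · simp
  have hpos : 0 < x ⬝ᵥ x := by simpa using dotProduct_star_self_pos_iff.mpr hx
  have := (le_csSup (isCompact_rayleighSet M).bddAbove (div_mem_rayleighSet M hpos)).trans hc
  linarith [(div_le_iff₀ hpos).mp this]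

theorem posSemidef_transpose_mul_mul {a b : ℕ} {M : Matrix (Fin a) (Fin a) ℝ}
    (hM : M.PosSemidef) (F : Matrix (Fin a) (Fin b) ℝ) : (Fᵀ * M * F).PosSemidef := by
  simpa [conjTranspose_eq_transpose_of_trivial] using hM.conjTranspose_mul_mul_same F

theorem posSemidef_transpose_mul_self {a b : ℕ} (F : Matrix (Fin a) (Fin b) ℝ) :
    (Fᵀ * F).PosSemidef := by
  simpa [conjTranspose_eq_transpose_of_trivial] using posSemidef_conjTranspose_mul_self F

theorem transpose_eq_of_isHermitian {a : ℕ} {M : Matrix (Fin a) (Fin a) ℝ}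
    (hM : M.IsHermitian) : Mᵀ = M := by
  simpa [conjTranspose_eq_transpose_of_trivial] using hM.eq

open scoped MatrixOrder in
theorem trace_mul_nonneg {a : ℕ} {M X : Matrix (Fin a) (Fin a) ℝ} (hM : M.PosSemidef)
    (hX : X.PosSemidef) : 0 ≤ (M * X).trace := by
  obtain ⟨F, rfl⟩ := CStarAlgebra.nonneg_iff_eq_star_mul_self.mp hM.nonneg
  rw [Matrix.mul_assoc, trace_mul_comm, star_eq_conjTranspose]
  exact (hX.mul_mul_conjTranspose_same F).trace_nonneg

theorem frobNormSq_eq_trace {a b : ℕ} (M : Matrix (Fin a) (Fin b) ℝ) :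
    frobNormSq M = (Mᵀ * M).trace := by
  rw [frobNormSq, Finset.sum_comm]
  simp [trace, mul_apply, pow_two]

theorem trace_transpose_mul_self_mul_le {a b : ℕ} (E : Matrix (Fin a) (Fin b) ℝ)
    {X : Matrix (Fin b) (Fin b) ℝ} (hX : X.IsHermitian) {c : ℝ} (hc : eigMax X ≤ c) :
    (Eᵀ * E * X).trace ≤ c * frobNormSq E := by
  have h := trace_mul_nonneg (posSemidef_transpose_mul_self E) (posSemidef_smul_one_sub hX hc)
  rw [Matrix.mul_sub, trace_sub, Matrix.mul_smul, Matrix.mul_one, trace_smul,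
    ← frobNormSq_eq_trace, smul_eq_mul] at h
  linarith

theorem sq_mul_frobNormSq_le {a b : ℕ} (E : Matrix (Fin a) (Fin b) ℝ)
    {X : Matrix (Fin b) (Fin b) ℝ} {c : ℝ} (hc : 0 ≤ c) (hX : (X - c • 1).PosSemidef) :
    c ^ 2 * frobNormSq E ≤ frobNormSq (E * X) := by
  have hXt : Xᵀ = X := by
    simpa [transpose_sub, transpose_smul] using transpose_eq_of_isHermitian hX.1
  have hsq : (X * X - c ^ 2 • (1 : Matrix (Fin b) (Fin b) ℝ)).PosSemidef := by
    have h := (posSemidef_transpose_mul_self (X - c • 1)).add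
      (hX.smul (mul_nonneg zero_le_two hc))
    convert h using 1
    rw [transpose_eq_of_isHermitian hX.1]
    simp only [Matrix.sub_mul, Matrix.mul_sub, Matrix.smul_mul, Matrix.mul_smul, Matrix.mul_one,
      Matrix.one_mul]
    module
  have h := trace_mul_nonneg (posSemidef_transpose_mul_self E) hsq
  rw [Matrix.mul_sub, trace_sub, Matrix.mul_smul, Matrix.mul_one, trace_smul,
    ← frobNormSq_eq_trace, smul_eq_mul] at h
  have htr : frobNormSq (E * X) = (Eᵀ * E * (X * X)).trace := by
    rw [frobNormSq_eq_trace, transpose_mul, hXt, Matrix.mul_assoc, trace_mul_comm]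
    simp only [Matrix.mul_assoc]
  linarith

/-- Completing the square: a concave quadratic in the gain increment is bounded by the squared
linear coefficient divided by the curvature. -/
theorem trace_concave_quadratic_le {a b : ℕ} {H : Matrix (Fin a) (Fin a) ℝ} {c : ℝ} (hc : 0 < c)
    (hH : (H - c • 1).PosSemidef) {X : Matrix (Fin b) (Fin b) ℝ} (hX : X.PosSemidef)
    (E V : Matrix (Fin a) (Fin b) ℝ) :
    ((Vᵀ * E + Eᵀ * V - Vᵀ * H * V) * X).trace ≤ c⁻¹ * (Eᵀ * E * X).trace := by
  have hpsd := ((posSemidef_transpose_mul_self (E - c • V)).smul (inv_nonneg.mpr hc.le)).add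
    (posSemidef_transpose_mul_mul hH V)
  have heq : c⁻¹ • ((E - c • V)ᵀ * (E - c • V)) + Vᵀ * (H - c • 1) * V
      = c⁻¹ • (Eᵀ * E) - (Vᵀ * E + Eᵀ * V - Vᵀ * H * V) := by
    simp only [transpose_sub, transpose_smul, Matrix.sub_mul, Matrix.mul_sub, Matrix.smul_mul,
      Matrix.mul_smul, Matrix.mul_one, smul_sub, smul_smul, inv_mul_cancel₀ hc.ne', one_smul,
      ← mul_assoc, one_mul]
    abel
  rw [heq] at hpsd
  have h := trace_mul_nonneg hpsd hX
  rw [Matrix.sub_mul, trace_sub, Matrix.smul_mul, trace_smul, smul_eq_mul] at h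
  linarith

namespace LQGame

variable {m d n N : ℕ}

theorem PKL_terminal (g : LQGame m d n N) (K : ℕ → Matrix (Fin d) (Fin m) ℝ)
    (L : ℕ → Matrix (Fin n) (Fin m) ℝ) : g.PKL K L N = g.QN := by
  simp [PKL, PKLaux]

theorem PK_terminal (g : LQGame m d n N) (K : ℕ → Matrix (Fin d) (Fin m) ℝ) :
    g.PK K N = g.QN := by
  simp [PK, PKaux]

theorem PKL_of_lt (g : LQGame m d n N) (K : ℕ → Matrix (Fin d) (Fin m) ℝ)
    (L : ℕ → Matrix (Fin n) (Fin m) ℝ) {t : ℕ} (ht : t < N) :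
    g.PKL K L t = (g.A t - g.B t * K t - g.D t * L t)ᵀ * g.PKL K L (t + 1) *
        (g.A t - g.B t * K t - g.D t * L t)
      + g.Q t + (K t)ᵀ * g.Ru t * K t - (L t)ᵀ * g.Rw t * L t := by
  have hs : N - t = N - (t + 1) + 1 := by omega
  have hr : N - (N - (t + 1) + 1) = t := by omega
  rw [PKL, hs, PKLaux, hr, PKL]

theorem PK_of_lt (g : LQGame m d n N) (K : ℕ → Matrix (Fin d) (Fin m) ℝ) {t : ℕ} (ht : t < N) :
    g.PK K t = g.Q t + (K t)ᵀ * g.Ru t * K t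
      + (g.A t - g.B t * K t)ᵀ * g.Ptilde K t * (g.A t - g.B t * K t) := by
  have hs : N - t = N - (t + 1) + 1 := by omega
  have hr : N - (N - (t + 1) + 1) = t := by omega
  rw [PK, hs, PKaux, hr, Ptilde, PK]

theorem PKL_transpose (g : LQGame m d n N) (K : ℕ → Matrix (Fin d) (Fin m) ℝ)
    (L : ℕ → Matrix (Fin n) (Fin m) ℝ) {t : ℕ} (ht : t ≤ N) :
    (g.PKL K L t)ᵀ = g.PKL K L t := by
  induction ht using Nat.decreasingInduction with
  | self => rw [PKL_terminal, transpose_eq_of_isHermitian g.hQN.1]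
  | of_succ t ht ih =>
    rw [PKL_of_lt g K L ht]
    simp only [transpose_add, transpose_sub, transpose_mul, transpose_transpose, ih,
      transpose_eq_of_isHermitian (g.hQ t ht).1, transpose_eq_of_isHermitian (g.hRu t ht).1,
      transpose_eq_of_isHermitian (g.hRw t ht).1, Matrix.mul_assoc]

theorem PK_transpose (g : LQGame m d n N) (K : ℕ → Matrix (Fin d) (Fin m) ℝ) {t : ℕ}
    (ht : t ≤ N) : (g.PK K t)ᵀ = g.PK K t := by
  induction ht using Nat.decreasingInduction with
  | self => rw [PK_terminal, transpose_eq_of_isHermitian g.hQN.1]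
  | of_succ t ht ih =>
    rw [PK_of_lt g K ht, Ptilde]
    simp only [transpose_add, transpose_sub, transpose_mul, transpose_transpose, ih,
      transpose_nonsing_inv, transpose_eq_of_isHermitian (g.hQ t ht).1,
      transpose_eq_of_isHermitian (g.hRu t ht).1,
      transpose_eq_of_isHermitian (g.hRw t ht).1, Matrix.mul_assoc]

/-- The value matrix of any maximizer gain is dominated by the inner-loop Riccati matrix. -/
theorem posSemidef_PK_sub_PKL (g : LQGame m d n N) {K : ℕ → Matrix (Fin d) (Fin m) ℝ}
    (hK : g.Admissible K) (L : ℕ → Matrix (Fin n) (Fin m) ℝ) {t : ℕ} (ht : t ≤ N) :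
    (g.PK K t - g.PKL K L t).PosSemidef := by
  induction ht using Nat.decreasingInduction with
  | self => rw [PK_terminal, PKL_terminal, sub_self]; exact .zero
  | of_succ t ht ih =>
    have hH := hK t ht
    have hPt := g.PK_transpose K (Nat.succ_le_of_lt ht)
    rw [PK_of_lt g K ht, PKL_of_lt g K L ht, Ptilde]
    set P := g.PK K (t + 1)
    set P' := g.PKL K L (t + 1)
    set M := g.A t - g.B t * K t
    set H := g.Rw t - (g.D t)ᵀ * P * g.D t with hHdef
    have hRw : g.Rw t = H + (g.D t)ᵀ * P * g.D t := by rw [hHdef]; abel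
    have hdet : IsUnit H.det := (isUnit_iff_isUnit_det H).mp hH.isUnit
    have hHi : (H⁻¹)ᵀ = H⁻¹ := by
      rw [transpose_nonsing_inv, transpose_eq_of_isHermitian hH.1]
    convert (posSemidef_transpose_mul_mul ih (M - g.D t * L t)).add
      (posSemidef_transpose_mul_mul hH.posSemidef (L t + H⁻¹ * ((g.D t)ᵀ * P * M))) using 1
    rw [hRw]
    simp only [transpose_add, transpose_sub, transpose_mul, transpose_transpose, hPt, hHi,
      Matrix.mul_add, Matrix.add_mul, Matrix.mul_sub, Matrix.sub_mul, Matrix.mul_assoc,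
      mul_nonsing_inv_cancel_left _ _ hdet, nonsing_inv_mul_cancel_left _ _ hdet]
    abel

theorem posSemidef_Xcov_sub_Sig (g : LQGame m d n N) (K : ℕ → Matrix (Fin d) (Fin m) ℝ)
    (L : ℕ → Matrix (Fin n) (Fin m) ℝ) {t : ℕ} (ht : t ≤ N) :
    (g.Xcov K L t - g.Sig t).PosSemidef := by
  induction t with
  | zero => rw [Xcov, sub_self]; exact .zero
  | succ t ih =>
    have hX := (ih (by omega)).add (g.hSig t (by omega)).posSemidef
    rw [sub_add_cancel] at hX
    rw [Xcov, add_sub_cancel_right]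
    simpa using posSemidef_transpose_mul_mul hX (g.A t - g.B t * K t - g.D t * L t)ᵀ

theorem posSemidef_Xcov (g : LQGame m d n N) (K : ℕ → Matrix (Fin d) (Fin m) ℝ)
    (L : ℕ → Matrix (Fin n) (Fin m) ℝ) {t : ℕ} (ht : t ≤ N) :
    (g.Xcov K L t).PosSemidef := by
  simpa using (g.posSemidef_Xcov_sub_Sig K L ht).add (g.hSig t ht).posSemidef

theorem PKL_sub_PKL (g : LQGame m d n N) (K : ℕ → Matrix (Fin d) (Fin m) ℝ)
    (L L' : ℕ → Matrix (Fin n) (Fin m) ℝ) {t : ℕ} (ht : t < N) :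
    g.PKL K L' t - g.PKL K L t =
      (g.A t - g.B t * K t - g.D t * L' t)ᵀ * (g.PKL K L' (t + 1) - g.PKL K L (t + 1)) *
          (g.A t - g.B t * K t - g.D t * L' t)
        + ((L' t - L t)ᵀ * g.Emat K L t + (g.Emat K L t)ᵀ * (L' t - L t)
          - (L' t - L t)ᵀ * g.Hmat K L t * (L' t - L t)) := by
  have hPt := g.PKL_transpose K L (Nat.succ_le_of_lt ht)
  have hRt := transpose_eq_of_isHermitian (g.hRw t ht).1
  rw [PKL_of_lt g K L ht, PKL_of_lt g K L' ht, Emat, Hmat]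
  generalize g.A t - g.B t * K t = M
  simp only [transpose_add, transpose_sub, transpose_neg, transpose_mul, transpose_transpose, hPt,
    hRt, Matrix.mul_add, Matrix.add_mul, Matrix.mul_sub, Matrix.sub_mul, Matrix.mul_neg,
    Matrix.neg_mul, Matrix.mul_assoc]
  abel

/-- Performance difference formula for the maximizer. -/
theorem value_sub_value (g : LQGame m d n N) (K : ℕ → Matrix (Fin d) (Fin m) ℝ)
    (L L' : ℕ → Matrix (Fin n) (Fin m) ℝ) :
    g.value K L' - g.value K L = ∑ t ∈ Finset.range N,
      (((L' t - L t)ᵀ * g.Emat K L t + (g.Emat K L t)ᵀ * (L' t - L t)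
        - (L' t - L t)ᵀ * g.Hmat K L t * (L' t - L t)) * g.Xcov K L' t).trace := by
  have key : ∀ k ≤ N, ∑ t ∈ Finset.range (k + 1),
      ((g.PKL K L' t - g.PKL K L t) * g.Sig t).trace = ∑ t ∈ Finset.range k,
      (((L' t - L t)ᵀ * g.Emat K L t + (g.Emat K L t)ᵀ * (L' t - L t)
        - (L' t - L t)ᵀ * g.Hmat K L t * (L' t - L t)) * g.Xcov K L' t).trace
      + ((g.PKL K L' k - g.PKL K L k) * g.Xcov K L' k).trace := by
    intro k hk
    induction k with
    | zero => simp [Xcov]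
    | succ k ih =>
      rw [Finset.sum_range_succ, ih (by omega), Finset.sum_range_succ _ k,
        g.PKL_sub_PKL K L L' (Nat.lt_of_succ_le hk), Xcov]
      simp only [Matrix.add_mul _ _ (g.Xcov K L' k), Matrix.mul_add (_ - _) _ (g.Sig (k + 1)),
        trace_add]
      generalize g.PKL K L' (k + 1) - g.PKL K L (k + 1) = W
      generalize g.A k - g.B k * K k - g.D k * L' k = F
      have hcycle : (Fᵀ * W * F * g.Xcov K L' k).trace = (W * (F * g.Xcov K L' k * Fᵀ)).trace := by
        rw [Matrix.mul_assoc, Matrix.mul_assoc, trace_mul_comm]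
        simp only [Matrix.mul_assoc]
      rw [hcycle]
      ring
  have h := key N le_rfl
  rw [PKL_terminal, PKL_terminal, sub_self, Matrix.zero_mul, trace_zero, add_zero] at h
  rw [← h, value, value, ← Finset.sum_sub_distrib]
  simp only [Matrix.sub_mul, trace_sub]

end LQGame

/-- Polyak–Łojasiewicz inequality for the inner loop. -/
theorem LQGame.inner_PL {m d n N : ℕ} (g : LQGame m d n N)
    (hN : 0 < N) (K : ℕ → Matrix (Fin d) (Fin m) ℝ) (hK : g.Admissible K) :
    ∀ L : ℕ → Matrix (Fin n) (Fin m) ℝ,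
      g.value K (g.Lopt K) - g.value K L ≤
        ((Finset.range (N+1)).sup' (Finset.nonempty_range_iff.mpr (Nat.succ_ne_zero N))
            (fun t => eigMax (g.Xcov K (g.Lopt K) t))
          / (g.phi ^ 2 * (Finset.range N).inf' (Finset.nonempty_range_iff.mpr hN.ne')
              (fun t => eigMin (g.Rw t - (g.D t)ᵀ * g.PK K (t+1) * g.D t))))
        * ∑ t ∈ Finset.range N, frobNormSq (g.Emat K L t * g.Xcov K L t) := by
  intro L
  rw [g.value_sub_value K L (g.Lopt K)]
  rcases Nat.eq_zero_or_pos m with rfl | hm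
  · simp [trace, frobNormSq]
  rcases Nat.eq_zero_or_pos n with rfl | hn
  · simp [trace, frobNormSq, mul_apply]
  set X' := g.Xcov K (g.Lopt K)
  set c := (Finset.range N).inf' (Finset.nonempty_range_iff.mpr hN.ne')
    (fun t => eigMin (g.Rw t - (g.D t)ᵀ * g.PK K (t+1) * g.D t))
  set lam := (Finset.range (N+1)).sup' (Finset.nonempty_range_iff.mpr (Nat.succ_ne_zero N))
    (fun t => eigMax (X' t))
  have hc : 0 < c := (Finset.lt_inf'_iff _).mpr fun t ht =>
    eigMin_pos hn (hK t (Finset.mem_range.mp ht))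
  have hphi : 0 < g.phi := (Finset.lt_inf'_iff _).mpr fun t ht =>
    eigMin_pos hm (g.hSig t (Finset.mem_range_succ_iff.mp ht))
  have hlam_ge : ∀ t ≤ N, eigMax (X' t) ≤ lam := fun t ht =>
    Finset.le_sup' (fun t => eigMax (X' t)) (Finset.mem_range_succ_iff.mpr ht)
  have hlam : 0 ≤ lam :=
    (eigMax_nonneg (g.posSemidef_Xcov K _ N.zero_le)).trans (hlam_ge 0 N.zero_le)
  rw [Finset.mul_sum]
  refine Finset.sum_le_sum fun t ht => ?_
  have htN : t < N := Finset.mem_range.mp ht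
  have hX' := g.posSemidef_Xcov K (g.Lopt K) htN.le
  have hH : (g.Hmat K L t - c • 1).PosSemidef := by
    have hle : c ≤ eigMin (g.Rw t - (g.D t)ᵀ * g.PK K (t+1) * g.D t) :=
      Finset.inf'_le (fun t => eigMin (g.Rw t - (g.D t)ᵀ * g.PK K (t+1) * g.D t)) ht
    have h := (posSemidef_sub_smul_one (hK t htN).1 hle).add
      (posSemidef_transpose_mul_mul
        (g.posSemidef_PK_sub_PKL hK L (Nat.succ_le_of_lt htN)) (g.D t))
    convert h using 1
    rw [Hmat, Matrix.mul_sub, Matrix.sub_mul]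
    abel
  have hX : (g.Xcov K L t - g.phi • 1).PosSemidef := by
    have hle : g.phi ≤ eigMin (g.Sig t) :=
      Finset.inf'_le _ (Finset.mem_range_succ_iff.mpr htN.le)
    simpa using (g.posSemidef_Xcov_sub_Sig K L htN.le).add
      (posSemidef_sub_smul_one (g.hSig t htN.le).1 hle)
  calc _ ≤ c⁻¹ * ((g.Emat K L t)ᵀ * g.Emat K L t * X' t).trace :=
        trace_concave_quadratic_le hc hH hX' _ _
    _ ≤ c⁻¹ * (lam * frobNormSq (g.Emat K L t)) := by
        gcongr
        exact trace_transpose_mul_self_mul_le _ hX'.1 (hlam_ge t htN.le)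
    _ = lam / (g.phi ^ 2 * c) * (g.phi ^ 2 * frobNormSq (g.Emat K L t)) := by
        field_simp
    _ ≤ lam / (g.phi ^ 2 * c) * frobNormSq (g.Emat K L t * g.Xcov K L t) := by
        gcongr
        exact sq_mul_frobNormSq_le _ hphi.le hX
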